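/- For every β > 0, λ > 0 and t > 0, ∫_{λt}^∞ ∫_0^∞ e^{β y} · ((x + y)/√(2π t³)) · e^{-(x+y)²/(2t)} dy dx = ∫_{λt}^∞ (2π t)^{-1/2} e^{-x²/(2t)} dx + (β/2) e^{β² t/2} ∫_{λt}^∞ Erfc((x - βt)/√(2t)) e^{-βx} dx. -/

import Mathlib

open MeasureTheory Real Set

/-- The complementary error function `Erfc`. -/
noncomputable def erfc (x : ℝ) : ℝ :=
  (2 / Real.sqrt Real.pi) * ∫ u in Set.Ioi x, Real.exp (-u ^ 2)

lemma gauss_int (t a : ℝ) (ht : 0 < t) :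
    Integrable (fun y : ℝ => Real.exp (-(1 / (2 * t)) * (y + a) ^ 2)) := by
  have h : (0:ℝ) < 1 / (2 * t) := by positivity
  exact (integrable_exp_neg_mul_sq h).comp_add_right a

lemma gauss_mul_int (t a : ℝ) (ht : 0 < t) :
    Integrable (fun y : ℝ => (y + a) * Real.exp (-(1 / (2 * t)) * (y + a) ^ 2)) := by
  have h : (0:ℝ) < 1 / (2 * t) := by positivity
  exact (integrable_mul_exp_neg_mul_sq h).comp_add_right a

lemma gauss_first_moment (t a : ℝ) (ht : 0 < t) :
    ∫ y in Set.Ioi (0:ℝ), (y + a) / t * Real.exp (-(1 / (2 * t)) * (y + a) ^ 2)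
      = Real.exp (-(1 / (2 * t)) * a ^ 2) := by
  have hd : ∀ y : ℝ, HasDerivAt (fun y : ℝ => - Real.exp (-(1 / (2 * t)) * (y + a) ^ 2))
      ((y + a) / t * Real.exp (-(1 / (2 * t)) * (y + a) ^ 2)) y := by
    intro y
    have h1 : HasDerivAt (fun y : ℝ => y + a) 1 y := (hasDerivAt_id y).add_const a
    have h2 := (((h1.pow 2).const_mul (-(1 / (2 * t)))).exp).neg
    refine h2.congr_deriv ?_
    simp
    field_simp
  have hi : Integrable (fun y : ℝ => (y + a) / t * Real.exp (-(1 / (2 * t)) * (y + a) ^ 2)) := by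
    refine ((gauss_mul_int t a ht).const_mul (1 / t)).congr (Filter.Eventually.of_forall fun y => ?_)
    simp only
    ring
  have ht0 := tendsto_zero_of_hasDerivAt_of_integrableOn_Ioi (a := 0) (fun y _ => hd y)
    hi.integrableOn (gauss_int t a ht).neg.integrableOn
  have := integral_Ioi_of_hasDerivAt_of_tendsto' (a := 0) (fun y _ => hd y) hi.integrableOn ht0
  rw [this]
  simp

lemma gauss_tail (t a : ℝ) (ht : 0 < t) :
    (Real.sqrt (2 * Real.pi * t))⁻¹ *
      ∫ y in Set.Ioi (0:ℝ), Real.exp (-(1 / (2 * t)) * (y + a) ^ 2)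
      = erfc (a / Real.sqrt (2 * t)) / 2 := by
  have hs : 0 < Real.sqrt (2 * t) := Real.sqrt_pos.2 (by positivity)
  have hsq : Real.sqrt (2 * t) ^ 2 = 2 * t := Real.sq_sqrt (by positivity)
  have hp : 0 < Real.sqrt Real.pi := Real.sqrt_pos.2 Real.pi_pos
  have hc : Real.sqrt (2 * Real.pi * t) = Real.sqrt (2 * t) * Real.sqrt Real.pi := by
    rw [← Real.sqrt_mul (by positivity)]; congr 1; ring
  have h1 := integral_comp_mul_left_Ioi (fun u : ℝ => Real.exp (-(u + a / Real.sqrt (2 * t)) ^ 2)) 0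
    (inv_pos.2 hs)
  have h2 : ∫ u in Set.Ioi (0:ℝ), Real.exp (-(u + a / Real.sqrt (2 * t)) ^ 2)
      = ∫ u in Set.Ioi (a / Real.sqrt (2 * t)), Real.exp (-u ^ 2) := by
    have h := (measurePreserving_add_right (volume : Measure ℝ)
      (a / Real.sqrt (2 * t))).setIntegral_preimage_emb
      (measurableEmbedding_addRight _) (fun u : ℝ => Real.exp (-u ^ 2))
      (Set.Ioi (a / Real.sqrt (2 * t)))
    simpa using h
  have h3 : ∫ y in Set.Ioi (0:ℝ), Real.exp (-(1 / (2 * t)) * (y + a) ^ 2)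
      = ∫ y in Set.Ioi (0:ℝ),
        Real.exp (-((Real.sqrt (2 * t))⁻¹ * y + a / Real.sqrt (2 * t)) ^ 2) := by
    congr 1
    funext y
    congr 1
    have e : (Real.sqrt (2 * t))⁻¹ * y + a / Real.sqrt (2 * t) = (y + a) / Real.sqrt (2 * t) := by
      ring
    rw [e, div_pow, hsq]
    ring
  rw [h3, h1, mul_zero, h2, hc, erfc, inv_inv, smul_eq_mul]
  field_simp

lemma inner_eq (β t x : ℝ) (ht : 0 < t) :
    (∫ y in Set.Ioi (0 : ℝ),
        Real.exp (β * y) * ((x + y) / Real.sqrt (2 * Real.pi * t ^ 3)) *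
          Real.exp (-(x + y) ^ 2 / (2 * t))) =
      (Real.sqrt (2 * Real.pi * t))⁻¹ * Real.exp (-x ^ 2 / (2 * t)) +
        (β / 2) * Real.exp (β ^ 2 * t / 2) *
          (erfc ((x - β * t) / Real.sqrt (2 * t)) * Real.exp (-β * x)) := by
  have hp := Real.pi_pos
  have hs : Real.sqrt (2 * Real.pi * t ^ 3) = t * Real.sqrt (2 * Real.pi * t) := by
    rw [show 2 * Real.pi * t ^ 3 = t ^ 2 * (2 * Real.pi * t) by ring,
      Real.sqrt_mul (by positivity), Real.sqrt_sq ht.le]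
  have hs0 : 0 < Real.sqrt (2 * Real.pi * t) := Real.sqrt_pos.2 (by positivity)
  set c := Real.sqrt (2 * Real.pi * t) with hcdef
  set K := c⁻¹ * (Real.exp (-β * x) * Real.exp (β ^ 2 * t / 2)) with hK
  have key : ∀ y : ℝ, Real.exp (β * y) * Real.exp (-(x + y) ^ 2 / (2 * t))
      = (Real.exp (-β * x) * Real.exp (β ^ 2 * t / 2)) *
        Real.exp (-(1 / (2 * t)) * (y + (x - β * t)) ^ 2) := by
    intro y
    rw [← Real.exp_add, ← Real.exp_add, ← Real.exp_add]
    congr 1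
    field_simp
    ring
  have h1 : ∀ y : ℝ, Real.exp (β * y) * ((x + y) / Real.sqrt (2 * Real.pi * t ^ 3)) *
          Real.exp (-(x + y) ^ 2 / (2 * t))
      = K * ((y + (x - β * t)) / t * Real.exp (-(1 / (2 * t)) * (y + (x - β * t)) ^ 2)) +
        K * β * Real.exp (-(1 / (2 * t)) * (y + (x - β * t)) ^ 2) := by
    intro y
    rw [hs, mul_right_comm, key, hK]
    field_simp
    ring
  simp_rw [h1]
  have hi : Integrable (fun y : ℝ => (y + (x - β * t)) / t *
      Real.exp (-(1 / (2 * t)) * (y + (x - β * t)) ^ 2)) := by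
    refine ((gauss_mul_int t (x - β * t) ht).const_mul (1 / t)).congr
      (Filter.Eventually.of_forall fun y => ?_)
    simp only
    ring
  rw [integral_add (hi.const_mul K).integrableOn
    ((gauss_int t (x - β * t) ht).const_mul (K * β)).integrableOn,
    integral_const_mul, integral_const_mul, gauss_first_moment t _ ht]
  have h2 := gauss_tail t (x - β * t) ht
  have h3 := key 0
  simp only [mul_zero, Real.exp_zero, one_mul, add_zero, zero_add] at h3
  rw [h3, hK]
  have h4 : erfc ((x - β * t) / Real.sqrt (2 * t)) =
    2 * (c⁻¹ * ∫ y in Set.Ioi (0:ℝ), Real.exp (-(1 / (2 * t)) * (y + (x - β * t)) ^ 2)) := by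
    rw [h2]; ring
  rw [h4]
  ring

lemma int_exp_sq : Integrable (fun u : ℝ => Real.exp (-u ^ 2)) := by
  simpa using integrable_exp_neg_mul_sq (b := 1) one_pos

lemma erfc_antitone : Antitone erfc := by
  intro x y h
  unfold erfc
  refine mul_le_mul_of_nonneg_left ?_ (by positivity)
  exact setIntegral_mono_set int_exp_sq.integrableOn
    (Filter.Eventually.of_forall fun u => (Real.exp_pos _).le)
    (Set.Ioi_subset_Ioi h).eventuallyLE

lemma erfc_nonneg (x : ℝ) : 0 ≤ erfc x := by
  unfold erfc
  exact mul_nonneg (by positivity) (integral_nonneg fun u => (Real.exp_pos _).le)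

lemma erfc_int (β l t : ℝ) (hβ : 0 < β) :
    IntegrableOn (fun x => erfc ((x - β * t) / Real.sqrt (2 * t)) * Real.exp (-β * x))
      (Set.Ioi (l * t)) := by
  refine Integrable.bdd_mul (c := erfc ((l * t - β * t) / Real.sqrt (2 * t)))
    (exp_neg_integrableOn_Ioi _ hβ) ?_ ?_
  · exact (erfc_antitone.measurable.comp (by fun_prop)).aestronglyMeasurable
  · refine (ae_restrict_iff' measurableSet_Ioi).2 (Filter.Eventually.of_forall fun x hx => ?_)
    rw [Real.norm_of_nonneg (erfc_nonneg _)]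
    apply erfc_antitone
    have : l * t < x := hx
    gcongr

/-- Both sides compute `Ẽ(e^{β L̃_t} 1_{ξ_t > λ t})`: the explicit identity between the
double integral against the joint density of position and local time and the closed form
for `E|N_t^{λ t}|`. -/
theorem joint_density_tail_identity (β l t : ℝ) (hβ : 0 < β) (hl : 0 < l) (ht : 0 < t) :
    (∫ x in Set.Ioi (l * t), ∫ y in Set.Ioi (0 : ℝ),
        Real.exp (β * y) * ((x + y) / Real.sqrt (2 * Real.pi * t ^ 3)) *
          Real.exp (-(x + y) ^ 2 / (2 * t))) =
      (∫ x in Set.Ioi (l * t),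
          (Real.sqrt (2 * Real.pi * t))⁻¹ * Real.exp (-x ^ 2 / (2 * t))) +
        (β / 2) * Real.exp (β ^ 2 * t / 2) *
          ∫ x in Set.Ioi (l * t),
            erfc ((x - β * t) / Real.sqrt (2 * t)) * Real.exp (-β * x) := by
  simp_rw [inner_eq β t _ ht]
  have hg : Integrable (fun x : ℝ =>
      (Real.sqrt (2 * Real.pi * t))⁻¹ * Real.exp (-x ^ 2 / (2 * t))) := by
    refine ((gauss_int t 0 ht).const_mul (Real.sqrt (2 * Real.pi * t))⁻¹).congr (Filter.Eventually.of_forall fun y => ?_)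
    simp only [add_zero]
    congr 2
    ring
  rw [integral_add hg.integrableOn ((erfc_int β l t hβ).const_mul _), integral_const_mul,
    integral_const_mul]
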